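/- arXiv:2305.01304 — 3 statements merged into one kernel-verified Lean document; each statement's English description precedes it below -/
import Mathlib

section
/- Let p be a prime, let N, r ≥ 1 and β_1, …, β_r ≥ 1 be integers, and put A := (ℤ/pℤ)^N. For each 1 ≤ j ≤ r let f_j : A → ℤ/p^{β_j}ℤ be a nonzero function and let d_j ≥ 1 be an integer with fdeg(f_j) ≤ d_j. Let Z := {x ∈ A : f_1(x) = ⋯ = f_r(x) = 0}. Then p^β divides #Z, where β := max(0, ⌈ (N − Σ_{j=1}^r ((p^{β_j} − 1)/(p − 1))·d_j) / (max_{j=1}^r p^{β_j − 1}·d_j) ⌉), the ceiling being taken of a rational number. -/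
/-- The difference operator `Δ_a` sending `f` to `x ↦ f (x + a) - f x`. -/
def disc {A B : Type*} [AddCommGroup A] [AddCommGroup B] (a : A) (f : A → B) : A → B :=
  fun x => f (x + a) - f x

/-- Iterated difference operator `Δ_{a_1} ⋯ Δ_{a_k} f` along a list `[a_1, …, a_k]`. -/
def multiDisc {A B : Type*} [AddCommGroup A] [AddCommGroup B] : List A → (A → B) → (A → B)
  | [], f => f
  | a :: l, f => disc a (multiDisc l f)

/-- `FdegLE f d` says that the functional degree of `f` is at most `d`, i.e. all
`(d+1)`-fold iterated differences of `f` vanish. -/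
def FdegLE {A B : Type*} [AddCommGroup A] [AddCommGroup B] (f : A → B) (d : ℕ) : Prop :=
  ∀ l : List A, l.length = d + 1 → multiDisc l f = 0

/-- Fleck–Weisman divisibility in a commutative ring. -/
theorem fleck_ring {R : Type*} [CommRing R] (p : ℕ) (hp : p.Prime) (a : ℕ) (x : R)
    (hx : x ^ (p ^ (a + 1)) = 1) (e : ℕ) :
    (p : R) ^ e ∣ (x - 1) ^ (p ^ a + e * ((p - 1) * p ^ a)) := by
  obtain ⟨q, rfl⟩ : ∃ q, p = q + 1 := ⟨p - 1, by have := hp.pos; omega⟩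
  have hq : 1 ≤ q := by have := hp.two_le; omega
  set P := q + 1 with hP
  set t := x - 1 with ht
  set y := x ^ P ^ a with hy
  obtain ⟨h, hh⟩ : ∃ h, t ^ P ^ a = (y - 1) + P * t * h := by
    obtain ⟨r, hr⟩ := exists_add_pow_prime_pow_eq hp t 1 a
    refine ⟨-r, ?_⟩
    have : t + 1 = x := by simp [ht]
    rw [this] at hr
    rw [hy, hr]; simp only [one_pow]; ring
  have hyp : ∃ w, (y - 1) ^ P = P * (y - 1) * w := by
    obtain ⟨r, hr⟩ := exists_add_pow_prime_eq hp (y - 1) 1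
    refine ⟨-r, ?_⟩
    have h1 : (y - 1 + 1) ^ P = 1 := by
      rw [sub_add_cancel, hy, ← pow_mul, ← pow_succ, hx]
    rw [h1] at hr
    simp only [one_pow] at hr
    linear_combination -hr
  obtain ⟨w, hw⟩ := hyp
  have hstep : ∃ s, (y - 1) * t ^ (q * P ^ a) = P * ((y - 1) * s) := by
    have h1 : t ^ (q * P ^ a) = (t ^ P ^ a) ^ q := by rw [mul_comm, pow_mul]
    obtain ⟨s, hs⟩ := sub_dvd_pow_sub_pow (t ^ P ^ a) (y - 1) q
    refine ⟨w + t * h * s, ?_⟩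
    rw [h1]
    have h2 : (y - 1) ^ P = (y - 1) * (y - 1) ^ q := by rw [hP, pow_succ']
    have h3 : t ^ P ^ a - (y - 1) = P * t * h := by rw [hh]; ring
    rw [h3] at hs
    linear_combination (y - 1) * hs + hw - h2
  have hiter : ∀ e : ℕ, ∃ s, (y - 1) * t ^ (e * (q * P ^ a)) = (P : R) ^ e * ((y - 1) * s) := by
    intro e
    induction e with
    | zero => exact ⟨1, by simp⟩
    | succ e ih =>
      obtain ⟨s, hs⟩ := ih
      obtain ⟨s', hs'⟩ := hstep
      refine ⟨s * s', ?_⟩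
      rw [Nat.succ_mul, pow_add, ← mul_assoc, hs]
      linear_combination (P : R) ^ e * s * hs'
  have hPq : P - 1 = q := by omega
  rw [hPq]
  induction e with
  | zero => simp
  | succ e ih =>
    rw [pow_add t, hh, add_mul]
    apply dvd_add
    · obtain ⟨s, hs⟩ := hiter (e + 1)
      rw [hs]; exact Dvd.intro _ rfl
    · have h1 : (P : R) ^ e ∣ t ^ (1 + (e + 1) * (q * P ^ a)) := by
        refine ih.trans (pow_dvd_pow _ ?_)
        have : P ^ a ≤ q * P ^ a := Nat.le_mul_of_pos_left _ hq
        nlinarith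
      have h2 : (P : R) * t * h * t ^ ((e + 1) * (q * P ^ a)) =
        P * t ^ (1 + (e + 1) * (q * P ^ a)) * h := by rw [pow_add]; ring
      rw [h2, pow_succ']
      exact Dvd.dvd.mul_right (mul_dvd_mul_left _ h1) _

/-- Mahler expansion of the indicator function of divisibility by `p^(a+1)`. -/
theorem fleck_indicator (p : ℕ) (hp : p.Prime) (a : ℕ) :
    ∃ c : ℕ → ℤ, (∀ k, (p : ℤ) ^ ((k - p ^ a) / ((p - 1) * p ^ a)) ∣ c k) ∧
      ∀ K y : ℕ, y < K → (∑ k ∈ Finset.range K, c k * (y.choose k : ℤ)) =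
        if (y : ZMod (p ^ (a + 1))) = 0 then 1 else 0 := by
  classical
  let R := AddMonoidAlgebra ℤ (ZMod (p ^ (a + 1)))
  let g : R := AddMonoidAlgebra.single 1 1
  have hg : ∀ n : ℕ, g ^ n = AddMonoidAlgebra.single (n : ZMod (p ^ (a + 1))) 1 := by
    intro n
    have := AddMonoidAlgebra.single_pow (1 : ZMod (p ^ (a + 1))) (1 : ℤ) n
    rw [nsmul_one, one_pow] at this
    exact this
  refine ⟨fun k => ((g - 1) ^ k).coeff 0, ?_, ?_⟩
  · intro k
    by_cases hk : k < p ^ a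
    · simp [Nat.sub_eq_zero_of_le hk.le]
    · have h1 := fleck_ring p hp a g (by rw [hg, ZMod.natCast_self]; rfl) ((k - p ^ a) / ((p - 1) * p ^ a))
      have h2 : (p : R) ^ ((k - p ^ a) / ((p - 1) * p ^ a)) ∣ (g - 1) ^ k := by
        refine h1.trans (pow_dvd_pow _ ?_)
        have := Nat.div_mul_le_self (k - p ^ a) ((p - 1) * p ^ a)
        omega
      obtain ⟨s, hs⟩ := h2
      refine ⟨s.coeff 0, ?_⟩
      show ((g - 1) ^ k).coeff 0 = _
      rw [hs]
      have : (p : R) ^ ((k - p ^ a) / ((p - 1) * p ^ a)) * s = ((p : ℤ) ^ ((k - p ^ a) / ((p - 1) * p ^ a))) • s := by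
        rw [zsmul_eq_mul]; push_cast; rfl
      rw [this]
      rfl
  · intro K y hy
    have h1 : g ^ y = ∑ k ∈ Finset.range (y + 1), (y.choose k : ℤ) • (g - 1) ^ k := by
      conv_lhs => rw [← sub_add_cancel g 1, add_pow]
      refine Finset.sum_congr rfl fun k _ => ?_
      simp [mul_comm]
    have h2 : g ^ y = ∑ k ∈ Finset.range K, (y.choose k : ℤ) • (g - 1) ^ k := by
      rw [h1]
      refine Finset.sum_subset (by simpa using hy) fun k _ hk => ?_
      rw [Nat.choose_eq_zero_of_lt (by simpa using hk)]; simp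
    let ev : R →+ ℤ := ⟨⟨fun f => f.coeff 0, rfl⟩, fun _ _ => rfl⟩
    have h3 := congrArg ev h2
    rw [map_sum] at h3
    have h4 : ev (g ^ y) = if (y : ZMod (p ^ (a + 1))) = 0 then 1 else 0 := by
      rw [hg]; exact Finsupp.single_apply
    rw [← h4, h3]
    refine Finset.sum_congr rfl fun k _ => ?_
    rw [map_zsmul, smul_eq_mul, mul_comm]; rfl

/-- All `n`-fold iterated differences of `g` along coordinate vectors vanish. -/
def DegLT {B : Type*} [AddCommGroup B] {N : ℕ} : ℕ → ((Fin N → ℕ) → B) → Prop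
  | 0, g => g = 0
  | n + 1, g => ∀ i : Fin N, DegLT n (fwdDiff (Pi.single i 1) g)

/-- Natural-number valued version of `DegLT`, with all differences nonnegative. -/
def NatDegLT {N : ℕ} : ℕ → ((Fin N → ℕ) → ℕ) → Prop
  | 0, g => g = 0
  | n + 1, g => ∀ i : Fin N, ∃ G : (Fin N → ℕ) → ℕ, NatDegLT n G ∧
      ∀ x, g (x + Pi.single i 1) = g x + G x

section
variable {B : Type*} [AddCommGroup B] {N : ℕ}

theorem DegLT.zero (n : ℕ) : DegLT n (0 : (Fin N → ℕ) → B) := by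
  induction n with
  | zero => rfl
  | succ n ih =>
    intro i
    have : fwdDiff (Pi.single i 1) (0 : (Fin N → ℕ) → B) = 0 := by ext x; simp [fwdDiff]
    rw [this]; exact ih

theorem DegLT.succ {n : ℕ} {g : (Fin N → ℕ) → B} (h : DegLT n g) : DegLT (n + 1) g := by
  induction n generalizing g with
  | zero => rw [show g = 0 from h]; exact DegLT.zero _
  | succ n ih => exact fun i => ih (h i)

theorem DegLT.mono {n m : ℕ} (hnm : n ≤ m) {g : (Fin N → ℕ) → B} (h : DegLT n g) :
    DegLT m g := by
  induction hnm with
  | refl => exact h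
  | step _ ih => exact ih.succ

theorem DegLT.add {n : ℕ} {f g : (Fin N → ℕ) → B} (hf : DegLT n f) (hg : DegLT n g) :
    DegLT n (f + g) := by
  induction n generalizing f g with
  | zero =>
    rw [show f = 0 from hf, show g = 0 from hg]; exact add_zero _
  | succ n ih =>
    intro i
    rw [fwdDiff_add]
    exact ih (hf i) (hg i)

theorem DegLT.sum {ι : Type*} {n : ℕ} (s : Finset ι) {f : ι → (Fin N → ℕ) → B}
    (hf : ∀ k ∈ s, DegLT n (f k)) : DegLT n (∑ k ∈ s, f k) := by
  classical
  induction s using Finset.induction_on with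
  | empty => simpa using DegLT.zero n
  | insert a s ha ih =>
    rw [Finset.sum_insert ha]
    exact (hf a (by simp)).add (ih fun k hk => hf k (by simp [hk]))

theorem DegLT.iter {n : ℕ} {g : (Fin N → ℕ) → B} (h : DegLT n g) (i : Fin N) (k : ℕ) :
    DegLT (n - k) ((fwdDiff (Pi.single i 1))^[k] g) := by
  induction k generalizing n g with
  | zero => simpa using h
  | succ k ih =>
    rw [Function.iterate_succ_apply]
    cases n with
    | zero =>
      have h0 : DegLT 0 (fwdDiff (Pi.single i 1) g) := by
        rw [show g = 0 from h]; ext x; simp [fwdDiff]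
      simpa using ih h0
    | succ n =>
      rw [Nat.succ_sub_succ]; exact ih (h i)

theorem cons_add_single_succ {N : ℕ} (a : ℕ) (x : Fin N → ℕ) (i : Fin N) :
    (Fin.cons a (x + Pi.single i 1) : Fin (N + 1) → ℕ) =
      (Fin.cons a x : Fin (N + 1) → ℕ) + Pi.single i.succ 1 := by
  ext j
  refine Fin.cases ?_ (fun j => ?_) j
  · simp [Pi.single_apply, (Fin.succ_ne_zero i).symm]
  · simp [Pi.single_apply]

theorem cons_zero_add_smul {N : ℕ} (a : ℕ) (x : Fin N → ℕ) :
    (Fin.cons 0 x : Fin (N + 1) → ℕ) + a • (Pi.single 0 1 : Fin (N + 1) → ℕ) = Fin.cons a x := by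
  ext j
  refine Fin.cases ?_ (fun j => ?_) j
  · simp
  · simp [Pi.single_apply]

theorem DegLT.restrict {n : ℕ} {g : (Fin (N + 1) → ℕ) → B} (h : DegLT n g) (a : ℕ) :
    DegLT n (fun x : Fin N → ℕ => g (Fin.cons a x)) := by
  induction n generalizing g with
  | zero => rw [show g = 0 from h]; rfl
  | succ n ih =>
    intro i
    have : fwdDiff (Pi.single i 1) (fun x : Fin N → ℕ => g (Fin.cons a x)) =
        fun x : Fin N → ℕ => (fwdDiff (Pi.single i.succ 1) g) (Fin.cons a x) := by
      ext x
      simp only [fwdDiff, cons_add_single_succ]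
    rw [this]
    exact ih (h i.succ)

theorem newton_cons {n : ℕ} {g : (Fin (N + 1) → ℕ) → B} (h : DegLT n g) (a : ℕ)
    (x : Fin N → ℕ) (K : ℕ) (hK : n ≤ K ∨ a < K) :
    g (Fin.cons a x) =
      ∑ k ∈ Finset.range K, a.choose k • ((fwdDiff (Pi.single 0 1))^[k] g) (Fin.cons 0 x) := by
  have h1 := shift_eq_sum_fwdDiff_iter (Pi.single 0 1 : Fin (N + 1) → ℕ) g a (Fin.cons 0 x)
  rw [cons_zero_add_smul] at h1
  rw [h1]
  have key : ∀ L, (n ≤ L ∨ a < L) → ∀ k ∉ Finset.range L,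
      a.choose k • ((fwdDiff (Pi.single 0 1))^[k] g) (Fin.cons 0 x) = 0 := by
    intro L hL k hk
    rw [Finset.mem_range, not_lt] at hk
    rcases hL with hL | hL
    · have h2 := h.iter 0 k
      rw [Nat.sub_eq_zero_of_le (hL.trans hk)] at h2
      rw [show (fwdDiff (Pi.single 0 1))^[k] g = 0 from h2]; simp
    · rw [Nat.choose_eq_zero_of_lt (by omega)]; simp
  rw [Finset.sum_subset (Finset.range_mono (le_max_left (a + 1) K))
      (fun k _ => key (a + 1) (Or.inr (by omega)) k),
    Finset.sum_subset (Finset.range_mono (le_max_right (a + 1) K)) (fun k _ => key K hK k)]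

end

theorem DegLT.const_one {N : ℕ} (m : ℕ) : DegLT (m + 1) (fun _ : Fin N → ℕ => (1 : ℤ)) := by
  intro i
  have : fwdDiff (Pi.single i 1) (fun _ : Fin N → ℕ => (1 : ℤ)) = 0 := by ext x; simp [fwdDiff]
  rw [this]; exact DegLT.zero _

theorem DegLT.mul {N : ℕ} {a b : ℕ} {f g : (Fin N → ℕ) → ℤ}
    (hf : DegLT (a + 1) f) (hg : DegLT (b + 1) g) : DegLT (a + b + 1) (f * g) := by
  obtain ⟨s, hs⟩ : ∃ s, s = a + b := ⟨_, rfl⟩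
  induction s using Nat.strong_induction_on generalizing a b f g with
  | _ s ih =>
  intro i
  have hfi := hf i
  have hgi := hg i
  set f' := fwdDiff (Pi.single i 1) f
  set g' := fwdDiff (Pi.single i 1) g
  have e : fwdDiff (Pi.single i 1) (f * g) = f' * g + f * g' + f' * g' := by
    ext x
    simp only [f', g', fwdDiff, Pi.mul_apply, Pi.add_apply]; ring
  rw [e]
  have z : ∀ {u : (Fin N → ℕ) → ℤ}, DegLT 0 u → u = 0 := fun h => h
  have h1 : DegLT (a + b) (f' * g) := by
    cases a with
    | zero => rw [z hfi, zero_mul]; exact DegLT.zero _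
    | succ a => exact (ih (a + b) (by omega) hfi hg rfl).mono (by omega)
  have h2 : DegLT (a + b) (f * g') := by
    cases b with
    | zero => rw [z hgi, mul_zero]; exact DegLT.zero _
    | succ b => exact (ih (a + b) (by omega) hf hgi rfl).mono (by omega)
  have h3 : DegLT (a + b) (f' * g') := by
    cases a with
    | zero => rw [z hfi, zero_mul]; exact DegLT.zero _
    | succ a => exact (ih (a + b) (by omega) hfi hgi.succ rfl).mono (by omega)
  exact (h1.add h2).add h3

theorem DegLT.prod {N : ℕ} {ι : Type*} (s : Finset ι) (n : ι → ℕ) (f : ι → (Fin N → ℕ) → ℤ)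
    (hf : ∀ k ∈ s, DegLT (n k + 1) (f k)) : DegLT (∑ k ∈ s, n k + 1) (∏ k ∈ s, f k) := by
  classical
  induction s using Finset.induction_on with
  | empty => exact DegLT.const_one _
  | insert a s ha ih =>
    rw [Finset.sum_insert ha, Finset.prod_insert ha]
    exact (hf a (by simp)).mul (ih fun k hk => hf k (by simp [hk]))

theorem NatDegLT.zero {N : ℕ} (n : ℕ) : NatDegLT n (0 : (Fin N → ℕ) → ℕ) := by
  induction n with
  | zero => rfl
  | succ n ih => exact fun i => ⟨0, ih, by simp⟩

theorem NatDegLT.add {N n : ℕ} {f g : (Fin N → ℕ) → ℕ} (hf : NatDegLT n f) (hg : NatDegLT n g) :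
    NatDegLT n (f + g) := by
  induction n generalizing f g with
  | zero => rw [show f = 0 from hf, show g = 0 from hg]; rfl
  | succ n ih =>
    intro i
    obtain ⟨F, hF, hF'⟩ := hf i
    obtain ⟨G, hG, hG'⟩ := hg i
    refine ⟨F + G, ih hF hG, fun x => ?_⟩
    simp only [Pi.add_apply, hF', hG']; ring

theorem NatDegLT.sum {N n : ℕ} {ι : Type*} (s : Finset ι) {f : ι → (Fin N → ℕ) → ℕ}
    (hf : ∀ k ∈ s, NatDegLT n (f k)) : NatDegLT n (∑ k ∈ s, f k) := by
  classical
  induction s using Finset.induction_on with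
  | empty => simpa using NatDegLT.zero n
  | insert a s ha ih =>
    rw [Finset.sum_insert ha]
    exact (hf a (by simp)).add (ih fun k hk => hf k (by simp [hk]))

theorem tail_add_single_zero {N : ℕ} (x : Fin (N + 1) → ℕ) :
    Fin.tail (x + Pi.single 0 1) = Fin.tail x := by
  ext j; simp [Fin.tail]

theorem tail_add_single_succ {N : ℕ} (x : Fin (N + 1) → ℕ) (i : Fin N) :
    Fin.tail (x + Pi.single i.succ 1) = Fin.tail x + Pi.single i 1 := by
  ext j; simp [Fin.tail, Pi.single_apply]

theorem NatDegLT.choose_mul {N n : ℕ} {G : (Fin N → ℕ) → ℕ} (hG : NatDegLT n G) (k : ℕ) :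
    NatDegLT (n + k) (fun x : Fin (N + 1) → ℕ => (x 0).choose k * G (Fin.tail x)) := by
  induction n generalizing G k with
  | zero =>
    rw [show G = 0 from hG]
    have : (fun x : Fin (N + 1) → ℕ => (x 0).choose k * (0 : (Fin N → ℕ) → ℕ) (Fin.tail x)) = 0 := by
      ext x; simp
    rw [this]; exact NatDegLT.zero _
  | succ n ih =>
    induction k with
    | zero =>
      intro i
      refine Fin.cases ?_ (fun i => ?_) i
      · exact ⟨0, NatDegLT.zero _, fun x => by simp [tail_add_single_zero]⟩
      · obtain ⟨F, hF, hF'⟩ := hG i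
        exact ⟨_, ih hF 0, fun x => by simp [tail_add_single_succ, hF']⟩
    | succ k ihk =>
      intro i
      refine Fin.cases ?_ (fun i => ?_) i
      · refine ⟨_, ihk, fun x => ?_⟩
        simp only [tail_add_single_zero, Pi.add_apply, Pi.single_eq_same, Nat.choose_succ_succ]
        ring
      · obtain ⟨F, hF, hF'⟩ := hG i
        refine ⟨_, (show n + 1 + k = n + (k + 1) by ring) ▸ ih hF (k + 1), fun x => ?_⟩
        simp only [tail_add_single_succ, Pi.add_apply, hF', Pi.single_apply,
          (Fin.succ_ne_zero i).symm, if_false, add_zero]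
        ring

/-- Lifting a `ZMod q` valued function to an `ℕ`-valued function. -/
theorem exists_lift (q : ℕ) [NeZero q] {N n : ℕ} (g : (Fin N → ℕ) → ZMod q) (hg : DegLT n g) :
    ∃ F : (Fin N → ℕ) → ℕ, NatDegLT n F ∧ ∀ x, (F x : ZMod q) = g x := by
  induction N generalizing n with
  | zero =>
    cases n with
    | zero => exact ⟨0, rfl, fun x => by rw [show g = 0 from hg]; simp⟩
    | succ n => exact ⟨fun x => (g x).val, fun i => i.elim0, fun x => by simp⟩
  | succ N ih =>
    choose G hG hG' using fun k => ih _ ((hg.iter 0 k).restrict 0)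
    refine ⟨∑ k ∈ Finset.range n, fun x => (x 0).choose k * G k (Fin.tail x), ?_, ?_⟩
    · refine NatDegLT.sum _ fun k hk => ?_
      have := (hG k).choose_mul k
      rwa [Nat.sub_add_cancel (Finset.mem_range.1 hk).le] at this
    · intro x
      conv_rhs => rw [← Fin.cons_self_tail x, newton_cons hg (x 0) (Fin.tail x) n (Or.inl le_rfl)]
      simp [hG']

theorem NatDegLT.choose {N d : ℕ} {F : (Fin N → ℕ) → ℕ} (hF : NatDegLT (d + 1) F) (k : ℕ) :
    DegLT (d * k + 1) (fun x => ((F x).choose k : ℤ)) := by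
  induction d generalizing F k with
  | zero =>
    intro i
    obtain ⟨G, hG, hG'⟩ := hF i
    rw [show G = 0 from hG] at hG'
    have : fwdDiff (Pi.single i 1) (fun x => ((F x).choose k : ℤ)) = 0 := by
      ext x; simp [fwdDiff, hG']
    rw [this]; exact DegLT.zero _
  | succ d ih =>
    induction k using Nat.strong_induction_on with
    | _ k ihk =>
    intro i
    obtain ⟨G, hG, hG'⟩ := hF i
    have e : fwdDiff (Pi.single i 1) (fun x => ((F x).choose k : ℤ)) =
        ∑ j ∈ Finset.range k, ((fun x => ((F x).choose j : ℤ)) *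
          (fun x => ((G x).choose (k - j) : ℤ))) := by
      ext x
      simp only [fwdDiff, hG', Nat.add_choose_eq, Finset.Nat.sum_antidiagonal_eq_sum_range_succ_mk,
        Finset.sum_range_succ, Finset.sum_apply, Pi.mul_apply]
      simp
    rw [e]
    refine DegLT.sum _ fun j hj => ?_
    have hj := Finset.mem_range.1 hj
    refine ((ihk j hj).mul (ih hG (k - j))).mono ?_
    obtain ⟨m, rfl⟩ : ∃ m, k = j + 1 + m := ⟨k - j - 1, by omega⟩
    rw [show j + 1 + m - j = m + 1 by omega]
    nlinarith

theorem sum_range_choose_hockey (p k : ℕ) :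
    ∑ a ∈ Finset.range p, a.choose k = p.choose (k + 1) := by
  induction p with
  | zero => simp
  | succ p ih => rw [Finset.sum_range_succ, ih, Nat.choose_succ_succ, add_comm]

/-- Divisibility of the sum of an integer-valued polynomial function over a box. -/
theorem box_sum (p : ℕ) (hp : p.Prime) {N n m : ℕ} (g : (Fin N → ℕ) → ℤ) (hg : DegLT n g)
    (h : m * (p - 1) + n ≤ (N + 1) * (p - 1)) :
    (p : ℤ) ^ m ∣ ∑ x : Fin N → Fin p, g (fun i => (x i : ℕ)) := by
  have hp2 := hp.two_le
  induction N generalizing n m with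
  | zero =>
    cases n with
    | zero => rw [show g = 0 from hg]; simp
    | succ n =>
      cases m with
      | zero => simp
      | succ m => exfalso; rw [Nat.succ_mul] at h; omega
  | succ N ih =>
    have e : ∑ x : Fin (N + 1) → Fin p, g (fun i => (x i : ℕ)) =
        ∑ k ∈ Finset.range p, (p.choose (k + 1) : ℤ) * ∑ x : Fin N → Fin p,
          ((fwdDiff (Pi.single 0 1))^[k] g) (Fin.cons 0 (fun i => (x i : ℕ))) := by
      rw [← (Fin.consEquiv (fun _ => Fin p)).sum_comp, Fintype.sum_prod_type, Finset.sum_comm]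
      have h1 : ∀ x : Fin N → Fin p, ∑ a : Fin p, g (fun i => ((Fin.consEquiv (fun _ => Fin p) (a, x) i : Fin p) : ℕ)) =
          ∑ k ∈ Finset.range p, (p.choose (k + 1) : ℤ) *
            ((fwdDiff (Pi.single 0 1))^[k] g) (Fin.cons 0 (fun i => (x i : ℕ))) := by
        intro x
        have h2 : ∀ a : Fin p, g (fun i => ((Fin.consEquiv (fun _ => Fin p) (a, x) i : Fin p) : ℕ)) =
            ∑ k ∈ Finset.range p, (a : ℕ).choose k •
              ((fwdDiff (Pi.single 0 1))^[k] g) (Fin.cons 0 (fun i => (x i : ℕ))) := by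
          intro a
          rw [← newton_cons hg (a : ℕ) (fun i => (x i : ℕ)) p (Or.inr a.2)]
          congr 1
          ext j
          refine Fin.cases ?_ (fun j => ?_) j <;> simp [Fin.consEquiv]
        simp only [h2]
        rw [Finset.sum_comm]
        refine Finset.sum_congr rfl fun k _ => ?_
        rw [← Finset.sum_smul, Fin.sum_univ_eq_sum_range (fun a => a.choose k),
          sum_range_choose_hockey]
        simp
      simp only [h1]
      rw [Finset.sum_comm]
      simp only [Finset.mul_sum]
    rw [e]
    refine Finset.dvd_sum fun k hk => ?_
    have hk := Finset.mem_range.1 hk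
    have hd := (hg.iter 0 k).restrict 0
    by_cases hkp : k = p - 1
    · subst hkp
      rw [Nat.sub_add_cancel hp.pos, Nat.choose_self, Nat.cast_one, one_mul]
      by_cases hn : n ≤ p - 1
      · rw [Nat.sub_eq_zero_of_le hn] at hd
        have h0 : ∀ x : Fin N → ℕ, ((fwdDiff (Pi.single 0 1))^[p - 1] g) (Fin.cons 0 x) = 0 :=
          fun x => congrFun hd x
        simp [h0]
      · refine ih _ hd ?_
        rw [Nat.succ_mul] at h; omega
    · cases m with
      | zero => simp
      | succ m =>
        rw [pow_succ']
        refine mul_dvd_mul ?_ (ih _ (hd.mono (Nat.sub_le _ _)) ?_)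
        · exact_mod_cast hp.dvd_choose_self (by omega) (by omega)
        · rw [Nat.succ_mul, Nat.succ_mul (N + 1)] at h; omega

theorem multiDisc_append_single {A B : Type*} [AddCommGroup A] [AddCommGroup B]
    (l : List A) (a : A) (f : A → B) : multiDisc (l ++ [a]) f = multiDisc l (disc a f) := by
  induction l with
  | nil => rfl
  | cons b l ih => simp only [List.cons_append, multiDisc, ih]

theorem degLT_of_multiDisc {B : Type*} [AddCommGroup B] {p N n : ℕ} (f : (Fin N → ZMod p) → B)
    (h : ∀ l : List (Fin N → ZMod p), l.length = n → multiDisc l f = 0) :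
    DegLT n (fun x : Fin N → ℕ => f (fun i => (x i : ZMod p))) := by
  induction n generalizing f with
  | zero =>
    have := h [] rfl
    rw [show f = 0 from this]; rfl
  | succ n ih =>
    intro i
    have e : fwdDiff (Pi.single i 1) (fun x : Fin N → ℕ => f (fun i => (x i : ZMod p))) =
        fun x : Fin N → ℕ => (disc (Pi.single i 1) f) (fun i => (x i : ZMod p)) := by
      ext x
      simp only [fwdDiff, disc]
      congr 2
      ext j
      by_cases hj : j = i
      · subst hj; simp
      · simp [hj]
    rw [e]
    refine ih _ fun l hl => ?_
    rw [← multiDisc_append_single]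
    exact h _ (by simp [hl])

/-- The core divisibility, with the exponent given by natural number inequalities. -/
theorem ax_katz_core (p : ℕ) (hp : p.Prime) (N r : ℕ) (a : Fin r → ℕ)
    (f : (j : Fin r) → (Fin N → ZMod p) → ZMod (p ^ (a j + 1)))
    (d : Fin r → ℕ) (hfd : ∀ j, FdegLE (f j) (d j)) (M S b : ℕ) (hM1 : 1 ≤ M)
    (hM : ∀ j, p ^ a j * d j ≤ M)
    (hS : (p - 1) * S = ∑ j, (p ^ (a j + 1) - 1) * d j)
    (hb : b * M + S < N) :
    p ^ (b + 1) ∣ Nat.card {x : Fin N → ZMod p // ∀ j, f j x = 0} := by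
  classical
  haveI : Fact p.Prime := ⟨hp⟩
  haveI : ∀ j, NeZero (p ^ (a j + 1)) := fun j => ⟨pow_ne_zero _ hp.ne_zero⟩
  choose F hF hF' using fun j => exists_lift (p ^ (a j + 1)) _ (degLT_of_multiDisc (f j) (hfd j))
  choose c hc hc' using fun j => fleck_indicator p hp (a j)
  obtain ⟨K, hK⟩ : ∃ K, ∀ j (x : Fin N → Fin p), F j (fun i => (x i : ℕ)) < K := by
    refine ⟨∑ j, ∑ x : Fin N → Fin p, F j (fun i => (x i : ℕ)) + 1, fun j x => ?_⟩
    refine Nat.lt_succ_of_le ?_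
    refine le_trans ?_ (Finset.single_le_sum (f := fun j => ∑ x : Fin N → Fin p, F j (fun i => (x i : ℕ))) (fun _ _ => Nat.zero_le _) (Finset.mem_univ j))
    exact Finset.single_le_sum (f := fun x : Fin N → Fin p => F j (fun i => (x i : ℕ)))
      (fun _ _ => Nat.zero_le _) (Finset.mem_univ x)
  let e1 : Fin p ≃ ZMod p :=
    { toFun := fun a => ((a : ℕ) : ZMod p)
      invFun := fun z => ⟨z.val, z.val_lt⟩
      left_inv := fun a => by ext; simp [ZMod.val_natCast, Nat.mod_eq_of_lt a.2]
      right_inv := fun z => by simp }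
  let e : (Fin N → Fin p) ≃ (Fin N → ZMod p) := Equiv.piCongrRight fun _ => e1
  have hcard : (Nat.card {x : Fin N → ZMod p // ∀ j, f j x = 0} : ℤ) =
      ∑ x : Fin N → Fin p, ∏ j, ∑ k ∈ Finset.range K,
        c j k * ((F j (fun i => (x i : ℕ))).choose k : ℤ) := by
    rw [Nat.card_eq_fintype_card, Fintype.card_subtype, Finset.card_filter, ← e.sum_comp]
    push_cast
    refine Finset.sum_congr rfl fun x _ => ?_
    have h1 : ∀ j, ∑ k ∈ Finset.range K, c j k * ((F j (fun i => (x i : ℕ))).choose k : ℤ) =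
        if f j (e x) = 0 then 1 else 0 := by
      intro j
      rw [hc' j K _ (hK j x), hF']
      rfl
    simp only [h1]
    rw [Finset.prod_ite_zero]
    simp
  have hmain : ((p : ℤ)) ^ (b + 1) ∣ (Nat.card {x : Fin N → ZMod p // ∀ j, f j x = 0} : ℤ) := by
    rw [hcard]
    simp only [Finset.prod_univ_sum, Finset.prod_mul_distrib]
    rw [Finset.sum_comm]
    refine Finset.dvd_sum fun k _ => ?_
    rw [← Finset.mul_sum]
    set E : Fin r → ℕ := fun j => (k j - p ^ a j) / ((p - 1) * p ^ a j) with hE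
    have h1 : (p : ℤ) ^ (∑ j, E j) ∣ ∏ j, c j (k j) := by
      rw [← Finset.prod_pow_eq_pow_sum]
      exact Finset.prod_dvd_prod_of_dvd _ _ fun j _ => hc j (k j)
    have hdeg : DegLT (∑ j, d j * k j + 1) (∏ j, fun x => ((F j x).choose (k j) : ℤ)) :=
      DegLT.prod _ _ _ fun j _ => (hF j).choose (k j)
    by_cases hEb : b + 1 ≤ ∑ j, E j
    · exact ((pow_dvd_pow _ hEb).trans h1).mul_right _
    · have hbE : b + 1 = ∑ j, E j + (b + 1 - ∑ j, E j) := by omega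
      rw [hbE, pow_add]
      refine mul_dvd_mul h1 ?_
      have h2 := box_sum p hp (m := b + 1 - ∑ j, E j) _ hdeg ?_
      · simpa only [Finset.prod_apply] using h2
      obtain ⟨q, rfl⟩ : ∃ q, p = q + 1 := ⟨p - 1, by have := hp.pos; omega⟩
      have hq : 1 ≤ q := by have := hp.two_le; omega
      simp only [Nat.add_sub_cancel] at *
      have hk : ∀ j, d j * k j ≤ ((q + 1) ^ (a j + 1) - 1) * d j + q * (E j * M) := by
        intro j
        have hpos : 0 < q * (q + 1) ^ a j := by positivity
        have h3 : k j ≤ ((q + 1) ^ (a j + 1) - 1) + E j * (q * (q + 1) ^ a j) := by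
          have h4 := Nat.lt_div_mul_add hpos (a := k j - (q + 1) ^ a j)
          have h5 : (q + 1) ^ (a j + 1) = q * (q + 1) ^ a j + (q + 1) ^ a j := by ring
          simp only [hE]
          omega
        calc d j * k j ≤ d j * (((q + 1) ^ (a j + 1) - 1) + E j * (q * (q + 1) ^ a j)) :=
              Nat.mul_le_mul_left _ h3
          _ = ((q + 1) ^ (a j + 1) - 1) * d j + q * (E j * ((q + 1) ^ a j * d j)) := by ring
          _ ≤ _ := by gcongr; exact hM j
      have hsum : ∑ j, d j * k j ≤ q * S + q * ((∑ j, E j) * M) := by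
        refine (Finset.sum_le_sum fun j _ => hk j).trans ?_
        rw [Finset.sum_add_distrib, hS, ← Finset.mul_sum, Finset.sum_mul]
      obtain ⟨m, hm⟩ : ∃ m, b = ∑ j, E j + m := ⟨b - ∑ j, E j, by omega⟩
      generalize ∑ j, E j = T at *
      subst hm
      rw [show T + m + 1 - T = m + 1 by omega]
      have h6 : m + T * M + S + 1 ≤ N := by nlinarith
      have h7 := Nat.mul_le_mul_left q h6
      nlinarith
  exact_mod_cast hmain

/-- **Theorem 1.7 (main theorem).** Let `A = (ℤ/pℤ)^N` and for `1 ≤ j ≤ r` let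
`f_j : A → ℤ/p^{β_j}ℤ` be a nonzero function of functional degree at most `d_j ≥ 1`. Then
`p ^ max(0, ⌈(N - ∑_j ((p^{β_j}-1)/(p-1)) d_j) / max_j p^{β_j-1} d_j⌉)` divides the number
of common zeros of the `f_j`. -/
theorem group_theoretic_ax_katz
    (p : ℕ) (hp : p.Prime) (N r : ℕ) (hN : 1 ≤ N) (hr : 1 ≤ r)
    (β : Fin r → ℕ) (hβ : ∀ j, 1 ≤ β j)
    (f : (j : Fin r) → (Fin N → ZMod p) → ZMod (p ^ β j))
    (hf0 : ∀ j, f j ≠ 0)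
    (d : Fin r → ℕ) (hd : ∀ j, 1 ≤ d j)
    (hfd : ∀ j, FdegLE (f j) (d j)) :
    p ^ (⌈((N : ℚ) - ∑ j, (((p : ℚ) ^ β j - 1) / ((p : ℚ) - 1)) * (d j : ℚ)) /
          (((Finset.univ.sup fun j => p ^ (β j - 1) * d j) : ℕ) : ℚ)⌉.toNat) ∣
      Nat.card {x : Fin N → ZMod p // ∀ j, f j x = 0} := by
  have hp2 := hp.two_le
  set M := Finset.univ.sup fun j => p ^ (β j - 1) * d j with hMdef
  have hM : ∀ j, p ^ (β j - 1) * d j ≤ M := fun j =>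
    Finset.le_sup (f := fun j => p ^ (β j - 1) * d j) (Finset.mem_univ j)
  have hM1 : 1 ≤ M := le_trans (Nat.mul_pos (pow_pos hp.pos _) (hd ⟨0, hr⟩)) (hM ⟨0, hr⟩)
  obtain ⟨a, rfl⟩ : ∃ a : Fin r → ℕ, β = fun j => a j + 1 :=
    ⟨fun j => β j - 1, funext fun j => by have := hβ j; show β j = β j - 1 + 1; omega⟩
  set S : ℕ := ∑ j, (∑ i ∈ Finset.range (a j + 1), p ^ i) * d j with hSdef
  have hS : (p - 1) * S = ∑ j, (p ^ (a j + 1) - 1) * d j := by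
    rw [hSdef, Finset.mul_sum]
    refine Finset.sum_congr rfl fun j _ => ?_
    rw [← mul_assoc, mul_comm (p - 1), Nat.geomSum_eq hp2,
      Nat.div_mul_cancel (by simpa using Nat.sub_dvd_pow_sub_pow p 1 (a j + 1))]
  have hSQ : ∑ j, (((p : ℚ) ^ (a j + 1) - 1) / ((p : ℚ) - 1)) * (d j : ℚ) = (S : ℚ) := by
    rw [hSdef]
    push_cast
    refine Finset.sum_congr rfl fun j _ => ?_
    rw [geom_sum_eq (by exact_mod_cast (by omega : p ≠ 1))]
  simp only [hSQ]
  set z := ⌈((N : ℚ) - (S : ℚ)) / (M : ℚ)⌉ with hz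
  rcases Nat.eq_zero_or_pos z.toNat with h0 | h0
  · rw [h0, pow_zero]; exact one_dvd _
  · obtain ⟨b, hb⟩ : ∃ b, z.toNat = b + 1 := ⟨z.toNat - 1, by omega⟩
    rw [hb]
    refine ax_katz_core p hp N r a f d hfd M S b hM1 (fun j => by simpa using hM j) hS ?_
    have hzb : (b : ℤ) < z := by omega
    rw [hz, Int.lt_ceil, lt_div_iff₀ (by exact_mod_cast hM1)] at hzb
    have : (b : ℚ) * M + S < N := by
      push_cast at hzb; linarith
    exact_mod_cast this
end

section
/- Let p be a prime, let N, α_1, …, α_N ≥ 1 be integers, put A := (ℤ/p^{α_1}ℤ) × ⋯ × (ℤ/p^{α_N}ℤ), and let π : ℤ^N → A be the coordinatewise reduction map. Let B be an abelian group and let F : ℤ^N → B be a function that factors through π, i.e., F = f ∘ π for some f : A → B. Then for every integer h ≥ 1 and every n ∈ ℕ^N with |n| > δ_p(α, h) := Σ_{i=1}^N (p^{α_i} − 1) + (h − 1)(p − 1) p^{max(α_1, …, α_N) − 1}, one has Δ^n F(x) ∈ p^h B for every x ∈ ℤ^N. -/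
/-- The multi-index iterated difference operator `Δ^n = Δ_1^{n_1} ⋯ Δ_N^{n_N}` on
functions `ℤ^N → B`, where `Δ_i = Δ_{e_i}` for the `i`-th standard basis vector. -/
def deltaPow {B : Type*} [AddCommGroup B] {N : ℕ} (n : Fin N → ℕ) (f : (Fin N → ℤ) → B) :
    (Fin N → ℤ) → B :=
  ((List.ofFn fun i => (disc (Pi.single i (1 : ℤ)))^[n i]).foldr (· ∘ ·) id) f

/-- modulo `p`, the geometric sum in `1 + X` is `X ^ (p-1)` -/
lemma aux_geom (p : ℕ) (hp : p.Prime) {R : Type*} [CommRing R] (w : R) :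
    (p : R) ∣ (∑ j ∈ Finset.range p, (1 + w) ^ j) - w ^ (p - 1) := by
  have : Fact p.Prime := ⟨hp⟩
  have key : (∑ j ∈ Finset.range p, (1 + Polynomial.X : Polynomial (ZMod p)) ^ j)
      = Polynomial.X ^ (p - 1) := by
    have h1 := mul_geom_sum (1 + Polynomial.X : Polynomial (ZMod p)) p
    rw [add_pow_char, one_pow] at h1
    apply mul_left_cancel₀ (Polynomial.X_ne_zero (R := ZMod p))
    rw [← pow_succ', Nat.sub_add_cancel hp.one_le]
    simpa using h1
  have h2 : Polynomial.C (p : ℤ) ∣ (∑ j ∈ Finset.range p, (1 + Polynomial.X : Polynomial ℤ) ^ j)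
      - Polynomial.X ^ (p - 1) := by
    rw [Polynomial.C_dvd_iff_dvd_coeff]
    intro i
    rw [← ZMod.intCast_zmod_eq_zero_iff_dvd]
    change Int.castRingHom (ZMod p) _ = 0
    rw [← Polynomial.coeff_map]
    simp [Polynomial.map_sum, key]
  obtain ⟨c, hc⟩ := h2
  refine ⟨Polynomial.aeval w c, ?_⟩
  have := congrArg (Polynomial.aeval w) hc
  simpa using this

lemma aux_frob (p : ℕ) (hp : p.Prime) (e : ℕ) {R : Type*} [CommRing R] (t : R) :
    (p : R) ∣ (1 + t) ^ (p ^ e) - 1 - t ^ (p ^ e) := by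
  obtain ⟨r, hr⟩ := exists_add_pow_prime_pow_eq hp (1 : R) t e
  rw [hr]
  exact ⟨1 * t * r, by ring⟩

lemma aux_ring (p : ℕ) (hp : p.Prime) (e : ℕ) {R : Type*} [CommRing R] (t : R)
    (hT : (1 + t) ^ (p ^ (e + 1)) = 1) (k : ℕ) :
    (p : R) ^ k ∣ t ^ (p ^ e + k * ((p - 1) * p ^ e)) := by
  obtain ⟨u, hu⟩ := aux_frob p hp e t
  obtain ⟨g, hg⟩ := aux_geom p hp ((1 + t) ^ (p ^ e) - 1)
  set W := (1 + t) ^ (p ^ e) - 1 with hW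
  have hWs : W * ∑ j ∈ Finset.range p, (1 + W) ^ j = 0 := by
    have h1 := mul_geom_sum (1 + W) p
    have h2 : (1 + W) ^ p = 1 := by
      rw [hW, add_sub_cancel, ← pow_mul, ← pow_succ, hT]
    rw [h2] at h1
    simpa using h1
  have htm : t ^ (p ^ e) = W - p * u := by rw [← hu]; ring
  have hpow : (p : R) ∣ W ^ (p - 1) - t ^ ((p - 1) * p ^ e) := by
    rw [mul_comm, pow_mul]
    exact Dvd.dvd.trans ⟨u, hu⟩ (sub_dvd_pow_sub_pow _ _ _)
  obtain ⟨v, hv⟩ := hpow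
  have hstep : W * t ^ ((p - 1) * p ^ e) = p * (W * (-(g + v))) := by
    linear_combination hWs - W * hg - W * hv
  have hWk : ∀ k : ℕ, (p : R) ^ k * W ∣ W * t ^ (k * ((p - 1) * p ^ e)) := by
    intro k
    induction k with
    | zero => simp
    | succ k ih =>
      obtain ⟨c, hc⟩ := ih
      refine ⟨c * (-(g + v)), ?_⟩
      rw [add_mul, one_mul, pow_add]
      linear_combination t ^ ((p - 1) * p ^ e) * hc + p ^ k * c * hstep
  induction k with
  | zero => simp
  | succ k ih =>
    rw [pow_add t, htm, sub_mul]
    refine dvd_sub (Dvd.dvd.trans (dvd_mul_right _ _) (hWk (k + 1))) ?_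
    rw [pow_succ', mul_assoc]
    refine mul_dvd_mul_left _ (Dvd.dvd.mul_left (ih.trans (pow_dvd_pow _ ?_)) _)
    have : 1 * p ^ e ≤ (p - 1) * p ^ e :=
      Nat.mul_le_mul_right _ (by have := hp.two_le; omega)
    rw [add_mul k 1]
    omega

lemma aux_poly (p : ℕ) (hp : p.Prime) (e n k : ℕ)
    (hk : k = 0 ∨ p ^ e + k * ((p - 1) * p ^ e) ≤ n) :
    ∃ a b : Polynomial ℤ, (Polynomial.X - 1) ^ n =
      (p : Polynomial ℤ) ^ k * a + b * (Polynomial.X ^ (p ^ (e + 1)) - 1) := by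
  rcases hk with rfl | hk
  · exact ⟨_, 0, by simp; rfl⟩
  set I : Ideal (Polynomial ℤ) := Ideal.span {Polynomial.X ^ (p ^ (e + 1)) - 1}
  have h1 := aux_ring p hp e (Ideal.Quotient.mk I (Polynomial.X - 1)) (by
    rw [← map_one (Ideal.Quotient.mk I), ← map_add, add_sub_cancel, ← map_pow,
      Ideal.Quotient.mk_eq_mk_iff_sub_mem]
    exact Ideal.mem_span_singleton_self _) k
  obtain ⟨c, hc⟩ := h1.trans (pow_dvd_pow _ hk)
  obtain ⟨a, rfl⟩ := Ideal.Quotient.mk_surjective c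
  rw [← map_natCast (Ideal.Quotient.mk I), ← map_pow, ← map_pow, ← map_mul,
    Ideal.Quotient.mk_eq_mk_iff_sub_mem, Ideal.mem_span_singleton'] at hc
  obtain ⟨b, hb⟩ := hc
  exact ⟨a, b, by rw [hb]; ring⟩

/-- translation by `a` as an endomorphism -/
def shiftEnd {A B : Type*} [AddCommGroup A] [AddCommGroup B] (a : A) :
    Module.End ℤ (A → B) where
  toFun f := fun x => f (x + a)
  map_add' _ _ := rfl
  map_smul' _ _ := rfl

lemma shiftEnd_apply {A B : Type*} [AddCommGroup A] [AddCommGroup B] (a : A) (f : A → B) (x : A) :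
    shiftEnd (B := B) a f x = f (x + a) := rfl

lemma shiftEnd_pow {A B : Type*} [AddCommGroup A] [AddCommGroup B] (a : A) (k : ℕ) :
    (shiftEnd a : Module.End ℤ (A → B)) ^ k = shiftEnd (k • a) := by
  induction k with
  | zero => ext f x; simp [shiftEnd_apply]
  | succ k ih =>
    rw [pow_succ, ih]
    ext f x
    simp [shiftEnd_apply, add_smul, add_assoc]

lemma disc_iterate {A B : Type*} [AddCommGroup A] [AddCommGroup B] (a : A) (k : ℕ) (f : A → B) :
    (disc a)^[k] f = ((shiftEnd a - 1 : Module.End ℤ (A → B)) ^ k) f := by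
  rw [Module.End.pow_apply]
  rfl

lemma shiftEnd_commute {A B : Type*} [AddCommGroup A] [AddCommGroup B] (a b : A) :
    Commute (shiftEnd a : Module.End ℤ (A → B)) (shiftEnd b) := by
  ext f x
  simp [shiftEnd_apply, add_right_comm]

lemma aux_step (p : ℕ) (hp : p.Prime) {A B ι : Type*} [AddCommGroup A] [AddCommGroup B]
    (s : ι → A) (e : ι → ℕ) (i : ι) (n k : ℕ)
    (hk : k = 0 ∨ p ^ e i + k * ((p - 1) * p ^ e i) ≤ n)
    (G : A → B) (hG : ∀ j, shiftEnd (B := B) (p ^ (e j + 1) • s j) G = G) :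
    ∃ G' : A → B, (∀ j, shiftEnd (B := B) (p ^ (e j + 1) • s j) G' = G') ∧
      (disc (s i))^[n] G = (p ^ k) • G' := by
  obtain ⟨a, b, hab⟩ := aux_poly p hp (e i) n k hk
  refine ⟨Polynomial.aeval (shiftEnd (s i) : Module.End ℤ (A → B)) a G, ?_, ?_⟩
  · intro j
    have hc : Commute (shiftEnd (B := B) (p ^ (e j + 1) • s j) : Module.End ℤ (A → B))
        (Polynomial.aeval (shiftEnd (s i) : Module.End ℤ (A → B)) a) := by
      rw [Polynomial.aeval_eq_sum_range]
      exact Commute.sum_right _ _ _ fun m _ =>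
        ((shiftEnd_commute _ _).pow_right m).smul_right _
    rw [← Module.End.mul_apply, hc.eq, Module.End.mul_apply, hG]
  · rw [disc_iterate]
    have h := congrArg (Polynomial.aeval (shiftEnd (s i) : Module.End ℤ (A → B))) hab
    have h' := congrArg (fun φ : Module.End ℤ (A → B) => φ G) h
    simp only [map_pow, map_sub, map_add, map_mul, Polynomial.aeval_X, map_one, map_natCast,
      LinearMap.add_apply, Module.End.mul_apply, LinearMap.sub_apply, shiftEnd_pow,
      hG, Module.End.one_apply, sub_self, map_zero, add_zero] at h'
    rw [h', ← Nat.cast_pow]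
    exact Module.End.natCast_apply _ _

lemma aux_count (p : ℕ) (N : ℕ) (hp : p.Prime) (α : Fin N → ℕ) (hα : ∀ i, 1 ≤ α i)
    (h : ℕ) (hh : 1 ≤ h) (n : Fin N → ℕ)
    (hn : (∑ i, (p ^ α i - 1)) + (h - 1) * (p - 1) * p ^ (Finset.univ.sup α - 1)
      < ∑ i, n i) :
    h ≤ ∑ i, (n i - p ^ (α i - 1)) / ((p - 1) * p ^ (α i - 1)) := by
  by_contra hc
  push Not at hc
  refine absurd hn (not_lt.mpr ?_)
  have hb : ∀ i, n i ≤ (p ^ α i - 1) + (n i - p ^ (α i - 1)) / ((p - 1) * p ^ (α i - 1)) *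
      ((p - 1) * p ^ (Finset.univ.sup α - 1)) := by
    intro i
    have hpos : 0 < (p - 1) * p ^ (α i - 1) :=
      Nat.mul_pos (by have := hp.two_le; omega) (pow_pos hp.pos _)
    have h1 := Nat.lt_div_mul_add hpos (a := n i - p ^ (α i - 1))
    have h2 : p ^ α i = p ^ (α i - 1) + (p - 1) * p ^ (α i - 1) := by
      conv_lhs => rw [← Nat.sub_add_cancel (hα i), pow_succ']
      obtain ⟨q, rfl⟩ : ∃ q, p = q + 1 := ⟨p - 1, (Nat.sub_add_cancel hp.one_le).symm⟩
      simp only [Nat.add_sub_cancel]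
      ring
    have h3 : (n i - p ^ (α i - 1)) / ((p - 1) * p ^ (α i - 1)) * ((p - 1) * p ^ (α i - 1)) ≤
        (n i - p ^ (α i - 1)) / ((p - 1) * p ^ (α i - 1)) *
      ((p - 1) * p ^ (Finset.univ.sup α - 1)) := by
      refine Nat.mul_le_mul_left _ (Nat.mul_le_mul_left _ (Nat.pow_le_pow_right hp.pos ?_))
      exact Nat.sub_le_sub_right (Finset.le_sup (Finset.mem_univ i)) 1
    omega
  calc ∑ i, n i ≤ _ := Finset.sum_le_sum fun i _ => hb i
    _ = (∑ i, (p ^ α i - 1)) + (∑ i, (n i - p ^ (α i - 1)) / ((p - 1) * p ^ (α i - 1))) *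
      ((p - 1) * p ^ (Finset.univ.sup α - 1)) := by
        rw [Finset.sum_add_distrib, Finset.sum_mul]
    _ ≤ _ := by
      rw [mul_assoc]
      exact Nat.add_le_add_left (Nat.mul_le_mul_right _ (by omega)) _

/-- **Theorem 2.21b/c.** Let `A = ℤ/p^{α_1}ℤ × ⋯ × ℤ/p^{α_N}ℤ` with reduction map
`π : ℤ^N → A`, and let `F : ℤ^N → B` factor through `π`. Then for every `h ≥ 1` and every
multi-index `n` with `|n| > δ_p(α, h) = ∑_i (p^{α_i} - 1) + (h-1)(p-1) p^{max α - 1}`,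
one has `Δ^n F x ∈ p^h B` for all `x`. -/
theorem deltaPow_mem_pow_smul_of_periodic
    (p : ℕ) (hp : p.Prime) (N : ℕ) (hN : 1 ≤ N)
    (α : Fin N → ℕ) (hα : ∀ i, 1 ≤ α i)
    {B : Type*} [AddCommGroup B]
    (F : (Fin N → ℤ) → B)
    (hF : ∃ f : (∀ i, ZMod (p ^ α i)) → B,
      F = fun x => f (fun i => ((x i : ℤ) : ZMod (p ^ α i))))
    (h : ℕ) (hh : 1 ≤ h) (n : Fin N → ℕ)
    (hn : (∑ i, (p ^ α i - 1)) + (h - 1) * (p - 1) * p ^ (Finset.univ.sup α - 1)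
      < ∑ i, n i) :
    ∀ x : Fin N → ℤ, ∃ b : B, deltaPow n F x = (p ^ h : ℕ) • b := by
  have hcount := aux_count p N hp α hα h hh n hn
  set k : Fin N → ℕ := fun i => (n i - p ^ (α i - 1)) / ((p - 1) * p ^ (α i - 1)) with hkdef
  set s : Fin N → (Fin N → ℤ) := fun i => Pi.single i 1 with hs
  have hk : ∀ i, k i = 0 ∨ p ^ (α i - 1) + k i * ((p - 1) * p ^ (α i - 1)) ≤ n i := by
    intro i
    have h1 : k i * ((p - 1) * p ^ (α i - 1)) ≤ n i - p ^ (α i - 1) := Nat.div_mul_le_self _ _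
    rcases le_total (p ^ (α i - 1)) (n i) with h2 | h2
    · right; omega
    · left; simp [hkdef, Nat.sub_eq_zero_of_le h2]
  have hFp : ∀ j, shiftEnd (B := B) (p ^ (α j - 1 + 1) • s j) F = F := by
    intro j
    obtain ⟨f, rfl⟩ := hF
    funext x
    rw [shiftEnd_apply]
    congr 1
    funext i
    rw [Nat.sub_add_cancel (hα j)]
    by_cases hij : i = j
    · subst hij
      have : ((p : ZMod (p ^ α i)) ^ α i) = 0 := by
        rw [← Nat.cast_pow]; exact ZMod.natCast_self _
      simp [hs, this]
    · simp [hs, hij]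
  have main : ∀ l : List (Fin N), ∃ G : (Fin N → ℤ) → B,
      (∀ j, shiftEnd (B := B) (p ^ (α j - 1 + 1) • s j) G = G) ∧
      ((l.map fun i => (disc (B := B) (s i))^[n i]).foldr (· ∘ ·) id) F =
        (p ^ (l.map k).sum) • G := by
    intro l
    induction l with
    | nil => exact ⟨F, hFp, by simp⟩
    | cons i l ih =>
      obtain ⟨G, hG, hl⟩ := ih
      obtain ⟨G', hG', hl'⟩ := aux_step p hp s (fun j => α j - 1) i (n i) (k i) (hk i) G hG
      refine ⟨G', hG', ?_⟩
      simp only [List.map_cons, List.foldr_cons, Function.comp_apply, List.sum_cons]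
      rw [hl, disc_iterate, map_nsmul, ← disc_iterate, hl', smul_smul, pow_add, mul_comm]
  obtain ⟨G, -, hG⟩ := main (List.finRange N)
  intro x
  refine ⟨(p ^ ((∑ i, k i) - h)) • G x, ?_⟩
  rw [smul_smul, ← pow_add, Nat.add_sub_cancel' hcount]
  rw [← List.ofFn_eq_map, ← List.ofFn_eq_map, List.sum_ofFn] at hG
  exact congrFun hG x
end

section
/- Let p be a prime, let N ≥ 1, and let R be a finite commutative ring of characteristic p with exactly p^N elements. Let n, r ≥ 1 and let f_1, …, f_r ∈ R[t_1, …, t_n] be polynomials each of total degree at least 1. Let Z := {x ∈ R^n : f_1(x) = ⋯ = f_r(x) = 0}. Then p^β divides #Z, where β := max(0, ⌈ N·(n − Σ_{j=1}^r σ_p(f_j)) / max_{j=1}^r σ_p(f_j) ⌉). -/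
/-- The `p`-weight degree `σ_p(f)` of a multivariate polynomial: the maximum over the
monomials `t_1^{d_1} ⋯ t_n^{d_n}` occurring in `f` (with nonzero coefficient) of
`σ_p(d_1) + ⋯ + σ_p(d_n)`, where `σ_p(d)` is the sum of the base-`p` digits of `d`. -/
def pWeightDeg (p : ℕ) {R : Type*} [CommSemiring R] {n : ℕ}
    (f : MvPolynomial (Fin n) R) : ℕ :=
  f.support.sup fun m => ∑ i, (Nat.digits p (m i)).sum


namespace MM
open Finset

/-- Newton kernel. -/
def K (a b : ℕ) : ℤ := (-1) ^ (a - b) * (a.choose b : ℤ)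

lemma K_sum_choose (p b : ℕ) (hb : b < p) :
    ∑ a ∈ range p, K a b * (p.choose (a + 1) : ℤ) = 1 := by
  let h : ℕ → ℤ := fun x => if x = b then 1 else 0
  let S : ℕ → ℤ := fun y => ∑ x ∈ range y, h x
  have hS : fwdDiff 1 S = h := by
    ext y
    simp [fwdDiff, S, sum_range_succ]
  have h1 := shift_eq_sum_fwdDiff_iter 1 S p 0
  rw [sum_range_succ'] at h1
  have h2 : S (0 + p • 1) = 1 := by
    simp [S, h, hb]
  have h3 : S 0 = 0 := by simp [S]
  rw [h2] at h1
  rw [h1]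
  simp only [Function.iterate_succ_apply, hS, Function.iterate_zero, id, h3, smul_zero, add_zero]
  refine sum_congr rfl fun a _ => ?_
  rw [fwdDiff_iter_eq_sum_shift]
  simp only [h, smul_eq_mul, mul_one, zero_add, mul_ite, mul_zero, sum_ite_eq', mem_range, nsmul_eq_mul]
  by_cases hab : b < a + 1
  · simp [hab, K, mul_comm]
  · simp [hab, K, Nat.choose_eq_zero_of_lt (show a < b by omega)]

lemma K_sum_pow (p a m : ℕ) (ha : a < p) (hm : m < a) :
    ∑ b ∈ range p, (K a b : ℚ) * (b : ℚ) ^ m = 0 := by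
  have h := congrFun (fwdDiff_iter_pow_eq_zero_of_lt (R := ℚ) hm) 0
  rw [fwdDiff_iter_eq_sum_shift] at h
  rw [← Finset.sum_subset (range_subset_range.2 (show a + 1 ≤ p by omega))]
  · simpa [K] using h
  · intro x _ hx
    have : a < x := by simpa using hx
    simp [K, Nat.choose_eq_zero_of_lt this]

variable {ι : Type*} [Fintype ι] [DecidableEq ι]

lemma sum_newton (p : ℕ) (g : (ι → ℕ) → ℤ) :
    ∑ x ∈ Fintype.piFinset (fun _ : ι => range p), g x =
      ∑ a ∈ Fintype.piFinset (fun _ : ι => range p),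
        (∑ b ∈ Fintype.piFinset (fun _ : ι => range p), (∏ k, K (a k) (b k)) * g b) *
          ∏ k, (p.choose (a k + 1) : ℤ) := by
  simp_rw [sum_mul]
  rw [sum_comm]
  refine sum_congr rfl fun b hb => ?_
  have : ∀ a : ι → ℕ, (∏ k, K (a k) (b k)) * g b * ∏ k, (p.choose (a k + 1) : ℤ) =
      (∏ k, (K (a k) (b k) * (p.choose (a k + 1) : ℤ))) * g b := by
    intro a; rw [prod_mul_distrib]; ring
  simp_rw [this]
  rw [← sum_mul, Finset.sum_prod_piFinset (range p) (fun k j => K j (b k) * (p.choose (j + 1) : ℤ))]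
  rw [prod_eq_one, one_mul]
  intro k _
  exact K_sum_choose p _ (by simpa using Fintype.mem_piFinset.1 hb k)

lemma newton_coeff_zero (p : ℕ) (P : MvPolynomial ι ℚ) (a : ι → ℕ) (ha : ∀ k, a k < p)
    (hd : P.totalDegree < ∑ k, a k) :
    ∑ b ∈ Fintype.piFinset (fun _ : ι => range p),
      (∏ k, (K (a k) (b k) : ℚ)) * MvPolynomial.eval (fun i => (b i : ℚ)) P = 0 := by
  simp_rw [MvPolynomial.eval_eq', mul_sum]
  rw [sum_comm]
  refine sum_eq_zero fun m hm => ?_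
  have : ∀ b : ι → ℕ, (∏ k, (K (a k) (b k) : ℚ)) * (MvPolynomial.coeff m P * ∏ i, (b i : ℚ) ^ m i)
      = MvPolynomial.coeff m P * ∏ k, ((K (a k) (b k) : ℚ) * (b k : ℚ) ^ m k) := by
    intro b; rw [prod_mul_distrib]; ring
  simp_rw [this]
  rw [← mul_sum, Finset.sum_prod_piFinset (range p) (fun k j => (K (a k) j : ℚ) * (j : ℚ) ^ m k)]
  obtain ⟨k, hk⟩ : ∃ k, m k < a k := by
    by_contra! hcon
    have h1 := MvPolynomial.le_totalDegree hm
    rw [Finsupp.sum_fintype _ _ (by simp)] at h1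
    have h2 : ∑ k, a k ≤ ∑ k, m k := sum_le_sum fun k _ => hcon k
    omega
  rw [prod_eq_zero (mem_univ k) (K_sum_pow p _ _ (ha k) hk), mul_zero]

lemma sum_dvd (p : ℕ) (hp : p.Prime) (P : MvPolynomial ι ℚ) (g : (ι → ℕ) → ℤ)
    (hg : ∀ x, (g x : ℚ) = MvPolynomial.eval (fun i => (x i : ℚ)) P) (T : ℕ)
    (hT : P.totalDegree ≤ (p - 1) * T) :
    (p : ℤ) ^ (Fintype.card ι - T) ∣ ∑ x ∈ Fintype.piFinset (fun _ : ι => range p), g x := by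
  rw [sum_newton]
  refine dvd_sum fun a ha => ?_
  have ha' : ∀ k, a k < p := fun k => by simpa using Fintype.mem_piFinset.1 ha k
  by_cases hd : P.totalDegree < ∑ k, a k
  · have h := newton_coeff_zero p P a ha' hd
    have h0 : ∑ b ∈ Fintype.piFinset (fun _ : ι => range p), (∏ k, K (a k) (b k)) * g b = 0 := by
      have : ((∑ b ∈ Fintype.piFinset (fun _ : ι => range p),
          (∏ k, K (a k) (b k)) * g b : ℤ) : ℚ) = 0 := by
        push_cast
        simp_rw [hg]
        exact h
      exact_mod_cast this
    rw [h0, zero_mul]; exact dvd_zero _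
  · apply Dvd.dvd.mul_left
    have h1 : ∏ k, (if a k = p - 1 then (1 : ℤ) else p) ∣ ∏ k, (p.choose (a k + 1) : ℤ) := by
      refine prod_dvd_prod_of_dvd _ _ fun k _ => ?_
      split_ifs with h
      · exact one_dvd _
      · have := ha' k
        exact_mod_cast hp.dvd_choose_self (by omega) (by omega)
    refine dvd_trans ?_ h1
    rw [prod_ite]
    simp only [prod_const_one, one_mul, prod_const]
    apply pow_dvd_pow
    have h2 := card_filter_add_card_filter_not (s := (univ : Finset ι)) (fun k => a k = p - 1)
    have h3 : #{k | a k = p - 1} * (p - 1) ≤ ∑ k, a k := by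
      rw [← smul_eq_mul, ← sum_const]
      calc _ = ∑ k with a k = p - 1, a k := sum_congr rfl fun k hk => by simp at hk; exact hk.symm
        _ ≤ _ := sum_le_sum_of_subset (filter_subset _ _)
    have h4 : #{k | a k = p - 1} ≤ T := by
      have := hp.two_le
      have h5 : 0 < p - 1 := by omega
      have h6 : #{k | a k = p - 1} * (p - 1) ≤ T * (p - 1) := by
        rw [mul_comm T]
        exact h3.trans ((not_lt.1 hd).trans hT)
      exact Nat.le_of_mul_le_mul_right h6 h5
    rw [card_univ] at h2
    omega

lemma periodic_step (p : ℕ) (hp : p.Prime) (w : ℕ → ℤ) (hw : ∀ y, w (y + p) = w y) :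
    ∃ u : ℕ → ℤ, (∀ y, u (y + p) = u y) ∧
      (fwdDiff 1)^[p] w = (p : ℤ) • fwdDiff 1 u := by
  have hper : ∀ k y, (fwdDiff 1)^[k] w (y + p) = (fwdDiff 1)^[k] w y := by
    intro k y
    rw [← fwdDiff_iter_comp_add]
    simp_rw [hw]
  refine ⟨-∑ k ∈ range (p - 1), ((p.choose (k + 1) / p : ℕ) : ℤ) • (fwdDiff 1)^[k] w, ?_, ?_⟩
  · intro y
    simp [hper]
  · ext y
    have h := shift_eq_sum_fwdDiff_iter 1 w p y
    obtain ⟨q, rfl⟩ : ∃ q, p = q + 1 := ⟨p - 1, by have := hp.two_le; omega⟩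
    rw [sum_range_succ', sum_range_succ] at h
    simp only [smul_eq_mul, mul_one, hw, Nat.choose_zero_right, one_smul, Function.iterate_zero, id,
      Nat.choose_self] at h
    have h5 : fwdDiff 1 (-∑ k ∈ range q, (((q + 1).choose (k + 1) / (q + 1) : ℕ) : ℤ) • (fwdDiff 1)^[k] w)
      = -∑ k ∈ range q, (((q + 1).choose (k + 1) / (q + 1) : ℕ) : ℤ) • (fwdDiff 1)^[k+1] w := by
      rw [← neg_one_smul ℤ, fwdDiff_const_smul, fwdDiff_finsetSum, neg_one_smul]
      simp only [fwdDiff_const_smul, Function.iterate_succ_apply']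
    have h6 : ∑ k ∈ range q, (q + 1).choose (k + 1) • (fwdDiff 1)^[k+1] w y =
      ((q + 1 : ℕ) : ℤ) * ∑ k ∈ range q, (((q + 1).choose (k + 1) / (q + 1) : ℕ) : ℤ) *
        (fwdDiff 1)^[k+1] w y := by
      rw [mul_sum]
      refine sum_congr rfl fun k hk => ?_
      rw [mem_range] at hk
      have hd : (q + 1) ∣ (q + 1).choose (k + 1) := hp.dvd_choose_self (by omega) (by omega)
      rw [← mul_assoc, ← Nat.cast_mul, Nat.mul_div_cancel' hd, nsmul_eq_mul]
    rw [Nat.add_sub_cancel, h5]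
    simp only [Pi.smul_apply, Pi.neg_apply, Finset.sum_apply, smul_eq_mul]
    rw [h6] at h
    linarith

lemma periodic_iter (p : ℕ) (hp : p.Prime) (w : ℕ → ℤ) (hw : ∀ y, w (y + p) = w y) (e : ℕ) :
    ∃ u : ℕ → ℤ, (∀ y, u (y + p) = u y) ∧
      (fwdDiff 1)^[(p - 1) * e + 1] w = ((p : ℤ) ^ e) • fwdDiff 1 u := by
  induction e with
  | zero => exact ⟨w, hw, by simp⟩
  | succ e ih =>
    obtain ⟨u, hu, h⟩ := ih
    obtain ⟨v, hv, h'⟩ := periodic_step p hp u hu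
    refine ⟨v, hv, ?_⟩
    rw [show (p - 1) * (e + 1) + 1 = (p - 1) + ((p - 1) * e + 1) by ring, Function.iterate_add_apply, h,
      fwdDiff_iter_const_smul, ← Function.iterate_succ_apply,
      show (p - 1).succ = p by have := hp.two_le; omega, h', smul_smul, pow_succ]

/-- Newton coefficients of the indicator of the multiples of `p`. -/
def c (p i : ℕ) : ℤ := (fwdDiff 1)^[i] (fun y : ℕ => if p ∣ y then (1 : ℤ) else 0) 0

lemma c_dvd (p : ℕ) (hp : p.Prime) (i : ℕ) : (p : ℤ) ^ ((i - 1) / (p - 1)) ∣ c p i := by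
  rcases Nat.eq_zero_or_pos i with rfl | hi
  · simp
  obtain ⟨u, -, h⟩ := periodic_iter p hp (fun y : ℕ => if p ∣ y then (1 : ℤ) else 0)
    (by intro y; simp) ((i - 1) / (p - 1))
  have h1 : (p - 1) * ((i - 1) / (p - 1)) ≤ i - 1 := Nat.mul_div_le _ _
  obtain ⟨s, hs⟩ := Nat.exists_eq_add_of_le' h1
  have : i = s + ((p - 1) * ((i - 1) / (p - 1)) + 1) := by omega
  unfold c
  generalize hE : (i - 1) / (p - 1) = E at *
  rw [this, Function.iterate_add_apply, h, fwdDiff_iter_const_smul]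
  simp

lemma ind_eq (p L y : ℕ) (hy : y ≤ L) :
    (if p ∣ y then (1 : ℤ) else 0) = ∑ i ∈ range (L + 1), c p i * (y.choose i : ℤ) := by
  have h := shift_eq_sum_fwdDiff_iter 1 (fun y : ℕ => if p ∣ y then (1 : ℤ) else 0) y 0
  simp only [smul_eq_mul, mul_one, zero_add, nsmul_eq_mul] at h
  rw [h]
  refine (sum_congr rfl fun i _ => mul_comm _ _).trans
    (sum_subset (range_subset_range.2 (by omega)) fun i _ hi => ?_)
  have : y < i := by simpa using hi
  simp [Nat.choose_eq_zero_of_lt this]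

lemma choose_poly (G : MvPolynomial ι ℕ) (i : ℕ) : ∃ P : MvPolynomial ι ℚ,
    P.totalDegree ≤ i * G.totalDegree ∧ ∀ x : ι → ℕ,
      (((MvPolynomial.eval x G).choose i : ℕ) : ℚ) = MvPolynomial.eval (fun k => (x k : ℚ)) P := by
  let Q : MvPolynomial ι ℚ := MvPolynomial.map (Nat.castRingHom ℚ) G
  have hQ : ∀ x : ι → ℕ, MvPolynomial.eval (fun k => (x k : ℚ)) Q = ((MvPolynomial.eval x G : ℕ) : ℚ) := by
    intro x
    simp only [Q, MvPolynomial.eval_map]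
    have := MvPolynomial.eval₂_comp_left (Nat.castRingHom ℚ) (RingHom.id ℕ) x G
    simpa [MvPolynomial.eval₂_id, Function.comp_def] using this.symm
  have hQd : Q.totalDegree ≤ G.totalDegree :=
    Finset.sup_mono (MvPolynomial.support_map_subset _ _)
  refine ⟨MvPolynomial.C ((i.factorial : ℚ)⁻¹) * ∏ k ∈ range i, (Q - MvPolynomial.C (k : ℚ)), ?_, ?_⟩
  · refine (MvPolynomial.totalDegree_mul _ _).trans ?_
    rw [MvPolynomial.totalDegree_C, zero_add]
    refine (MvPolynomial.totalDegree_finsetProd _ _).trans ?_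
    refine (sum_le_card_nsmul _ _ G.totalDegree fun k _ => ?_).trans (by simp)
    exact (MvPolynomial.totalDegree_sub_C_le _ _).trans hQd
  · intro x
    have := descPochhammer_eval_eq_prod_range (R := ℚ) i ((MvPolynomial.eval x G : ℕ) : ℚ)
    rw [map_mul, map_prod]
    simp only [map_sub, MvPolynomial.eval_C, hQ]
    rw [← this, descPochhammer_eval_eq_descFactorial, Nat.descFactorial_eq_factorial_mul_choose]
    push_cast
    rw [inv_mul_cancel_left₀]
    exact_mod_cast i.factorial_ne_zero

theorem ax_katz (p : ℕ) (hp : p.Prime) {J : Type*} [Fintype J] [DecidableEq J]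
    (G : J → MvPolynomial ι ℕ) (d : J → ℕ) (D : ℕ) (hD : 1 ≤ D) (hdD : ∀ j, d j ≤ D)
    (hG : ∀ j, (G j).totalDegree ≤ d j) (β : ℕ)
    (hβ : ∀ v : ℕ, Fintype.card ι ≤ ∑ j, d j + D * v → β ≤ v) :
    p ^ β ∣ #{x ∈ Fintype.piFinset (fun _ : ι => range p) | ∀ j, p ∣ MvPolynomial.eval x (G j)} := by
  obtain ⟨L, hL⟩ : ∃ L, ∀ x ∈ Fintype.piFinset (fun _ : ι => range p), ∀ j,
      MvPolynomial.eval x (G j) ≤ L :=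
    ⟨∑ x ∈ Fintype.piFinset (fun _ : ι => range p), ∑ j, MvPolynomial.eval x (G j),
      fun x hx j => (single_le_sum (f := fun j => MvPolynomial.eval x (G j))
        (fun _ _ => Nat.zero_le _) (mem_univ j)).trans
        (single_le_sum (f := fun x => ∑ j, MvPolynomial.eval x (G j)) (fun _ _ => Nat.zero_le _) hx)⟩
  have key : ((#{x ∈ Fintype.piFinset (fun _ : ι => range p) |
      ∀ j, p ∣ MvPolynomial.eval x (G j)} : ℕ) : ℤ) =
      ∑ i ∈ Fintype.piFinset (fun _ : J => range (L + 1)), (∏ j, c p (i j)) *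
        ∑ x ∈ Fintype.piFinset (fun _ : ι => range p),
          ∏ j, ((MvPolynomial.eval x (G j)).choose (i j) : ℤ) := by
    rw [card_filter]
    push_cast
    simp_rw [mul_sum]
    rw [sum_comm]
    refine sum_congr rfl fun x hx => ?_
    simp_rw [← prod_mul_distrib]
    rw [Finset.sum_prod_piFinset (range (L + 1))
      (fun j k => c p k * ((MvPolynomial.eval x (G j)).choose k : ℤ))]
    rw [← prod_congr rfl fun j _ => ind_eq p L _ (hL x hx j)]
    split_ifs with h
    · simp [h]
    · push Not at h
      obtain ⟨j, hj⟩ := h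
      exact (prod_eq_zero (mem_univ j) (by simp [hj])).symm
  rw [← Int.natCast_dvd_natCast, key]
  refine dvd_sum fun i _ => ?_
  let e : J → ℕ := fun j => (i j - 1) / (p - 1)
  have hp2 := hp.two_le
  have hie : ∀ j, i j ≤ (p - 1) * (e j + 1) := by
    intro j
    have := Nat.lt_mul_div_succ (i j - 1) (show 0 < p - 1 by omega)
    change i j - 1 < (p - 1) * (e j + 1) at this
    omega
  choose P hP hP' using fun j => choose_poly (G j) (i j)
  have h1 : (p : ℤ) ^ (∑ j, e j) ∣ ∏ j, c p (i j) := by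
    rw [← prod_pow_eq_pow_sum]
    exact prod_dvd_prod_of_dvd _ _ fun j _ => c_dvd p hp (i j)
  have h2 := sum_dvd p hp (∏ j, P j)
    (fun x => ∏ j, ((MvPolynomial.eval x (G j)).choose (i j) : ℤ))
    (by intro x; push_cast; rw [map_prod]; exact prod_congr rfl fun j _ => hP' j x)
    (∑ j, d j * (e j + 1))
    (by
      refine (MvPolynomial.totalDegree_finsetProd _ _).trans ?_
      rw [mul_sum]
      refine sum_le_sum fun j _ => (hP j).trans ?_
      calc i j * (G j).totalDegree ≤ ((p - 1) * (e j + 1)) * d j := Nat.mul_le_mul (hie j) (hG j)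
        _ = _ := by ring)
  have h3 := mul_dvd_mul h1 h2
  rw [← pow_add] at h3
  refine dvd_trans ?_ h3
  push_cast
  apply pow_dvd_pow
  apply hβ
  have h4 : ∑ j, d j * (e j + 1) ≤ ∑ j, d j + D * ∑ j, e j := by
    rw [mul_sum, ← sum_add_distrib]
    refine sum_le_sum fun j _ => ?_
    have := Nat.mul_le_mul_right (e j) (hdD j)
    linarith
  generalize hX : ∑ j, d j * (e j + 1) = X at *
  have h5 : Fintype.card ι - X ≤ D * (Fintype.card ι - X) := Nat.le_mul_of_pos_left _ hD
  rw [mul_add]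
  omega

end MM

namespace MM
open Finset

variable {R : Type*} [CommRing R]

lemma pow_poly (p : ℕ) (hp : p.Prime) [CharP R p] {ι : Type*} {N : ℕ} (v : Fin N → ι) (d : ℕ) :
    ∀ b : Fin N → R, ∃ g : MvPolynomial ι R, g.totalDegree ≤ (Nat.digits p d).sum ∧
      ∀ y : ι → ℕ, MvPolynomial.eval (fun k => (y k : R)) g = (∑ l, (y (v l) : R) * b l) ^ d := by
  haveI : Fact p.Prime := ⟨hp⟩
  induction d using Nat.strong_induction_on with
  | _ d ih =>
    intro b
    rcases Nat.eq_zero_or_pos d with rfl | hd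
    · exact ⟨1, by simp, by simp⟩
    obtain ⟨g, hg, hg'⟩ := ih (d / p) (Nat.div_lt_self hd hp.one_lt) (fun l => b l ^ p)
    refine ⟨(∑ l, MvPolynomial.C (b l) * MvPolynomial.X (v l)) ^ (d % p) * g, ?_, ?_⟩
    · rw [Nat.digits_def' hp.one_lt hd, List.sum_cons]
      refine (MvPolynomial.totalDegree_mul _ _).trans (Nat.add_le_add ?_ hg)
      refine (MvPolynomial.totalDegree_pow _ _).trans ?_
      refine (Nat.mul_le_mul_left _ ?_).trans (mul_one _).le
      refine MvPolynomial.totalDegree_finsetSum_le fun l _ => ?_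
      refine (MvPolynomial.totalDegree_mul _ _).trans ?_
      rw [MvPolynomial.totalDegree_C, zero_add]
      refine (MvPolynomial.totalDegree_monomial_le _ _).trans ?_
      simp
    · intro y
      have h1 : (∑ l, (y (v l) : R) * b l) ^ p = ∑ l, (y (v l) : R) * b l ^ p := by
        have := map_sum (frobenius R p) (fun l => (y (v l) : R) * b l) univ
        simp only [map_mul, map_natCast] at this
        simpa only [frobenius_def] using this
      rw [map_mul, map_pow, hg', ← h1, ← pow_mul]
      simp only [map_sum, map_mul, MvPolynomial.eval_C, MvPolynomial.eval_X]
      simp_rw [mul_comm (b _)]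
      rw [← pow_add, Nat.mod_add_div]

lemma f_poly (p : ℕ) (hp : p.Prime) [CharP R p] {n N : ℕ} (b : Fin N → R)
    (f : MvPolynomial (Fin n) R) :
    ∃ g : MvPolynomial (Fin n × Fin N) R, g.totalDegree ≤ pWeightDeg p f ∧
      ∀ y : Fin n × Fin N → ℕ, MvPolynomial.eval (fun k => (y k : R)) g =
        MvPolynomial.eval (fun i => ∑ l, (y (i, l) : R) * b l) f := by
  choose g hg hg' using fun (i : Fin n) (d : ℕ) => pow_poly p hp (fun l : Fin N => (i, l)) d b
  refine ⟨∑ m ∈ f.support, MvPolynomial.C (f.coeff m) * ∏ i, g i (m i), ?_, ?_⟩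
  · refine MvPolynomial.totalDegree_finsetSum_le fun m hm => ?_
    refine (MvPolynomial.totalDegree_mul _ _).trans ?_
    rw [MvPolynomial.totalDegree_C, zero_add]
    refine (MvPolynomial.totalDegree_finsetProd _ _).trans ?_
    refine (sum_le_sum fun i _ => hg i (m i)).trans ?_
    exact Finset.le_sup (f := fun m : Fin n →₀ ℕ => ∑ i, (Nat.digits p (m i)).sum) hm
  · intro y
    rw [MvPolynomial.eval_eq' _ f]
    simp only [map_sum, map_mul, map_prod, MvPolynomial.eval_C, hg']

lemma nat_poly (p : ℕ) [NeZero p] [Algebra (ZMod p) R] {ι : Type*} [Fintype ι]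
    (g : MvPolynomial ι R) (φ : R →ₗ[ZMod p] ZMod p) :
    ∃ G : MvPolynomial ι ℕ, G.totalDegree ≤ g.totalDegree ∧ ∀ y : ι → ℕ,
      ((MvPolynomial.eval y G : ℕ) : ZMod p) = φ (MvPolynomial.eval (fun k => (y k : R)) g) := by
  refine ⟨∑ m ∈ g.support, MvPolynomial.monomial m (φ (g.coeff m)).val, ?_, ?_⟩
  · refine MvPolynomial.totalDegree_finsetSum_le fun m hm => ?_
    exact (MvPolynomial.totalDegree_monomial_le _ _).trans (MvPolynomial.le_totalDegree hm)
  · intro y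
    rw [MvPolynomial.eval_eq' _ g, map_sum, map_sum]
    push_cast
    refine sum_congr rfl fun m _ => ?_
    have : MvPolynomial.coeff m g * ∏ i, (y i : R) ^ m i =
        (∏ i, (y i : ZMod p) ^ m i) • MvPolynomial.coeff m g := by
      rw [Algebra.smul_def, mul_comm]; simp
    rw [this, map_smul, MvPolynomial.eval_monomial, Finsupp.prod_fintype _ _ (by simp)]
    push_cast
    rw [ZMod.natCast_zmod_val, smul_eq_mul, mul_comm]

end MM

/-- **Generalized Moreno-Moreno Theorem.** Let `R` be a finite commutative ring of prime
characteristic `p` with `p ^ N` elements, and let `f_1, …, f_r` be multivariate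
polynomials over `R` in `n` variables of total degree at least `1`. Then
`p ^ max(0, ⌈N (n - ∑_j σ_p(f_j)) / max_j σ_p(f_j)⌉)` divides the number of common
zeros. -/
theorem generalized_moreno_moreno
    (p : ℕ) (hp : p.Prime) (N : ℕ) (hN : 1 ≤ N)
    (R : Type*) [CommRing R] [Fintype R] [CharP R p]
    (hcard : Fintype.card R = p ^ N)
    (n r : ℕ) (hn : 1 ≤ n) (hr : 1 ≤ r)
    (f : Fin r → MvPolynomial (Fin n) R)
    (hdeg : ∀ j, 1 ≤ (f j).totalDegree) :
    p ^ (⌈((N : ℚ) * ((n : ℚ) - ∑ j, (pWeightDeg p (f j) : ℚ))) /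
          (((Finset.univ.sup fun j => pWeightDeg p (f j)) : ℕ) : ℚ)⌉.toNat) ∣
      Nat.card {x : Fin n → R // ∀ j, MvPolynomial.eval x (f j) = 0} := by
  haveI : Fact p.Prime := ⟨hp⟩
  haveI : NeZero p := ⟨hp.ne_zero⟩
  letI : Algebra (ZMod p) R := ZMod.algebra R p
  have hfin : Module.finrank (ZMod p) R = N := by
    have h := Module.card_eq_pow_finrank (K := ZMod p) (V := R)
    rw [hcard, ZMod.card] at h
    exact (Nat.pow_right_injective hp.two_le h).symm
  let b := Module.finBasisOfFinrankEq (ZMod p) R hfin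
  choose g hg hg' using fun j => MM.f_poly p hp b (f j)
  choose G hG hG' using fun jl : Fin r × Fin N => MM.nat_poly p (g jl.1) (b.coord jl.2)
  have hval : ∀ y : Fin n × Fin N → ℕ, (∀ jl, p ∣ MvPolynomial.eval y (G jl)) ↔
      ∀ j, MvPolynomial.eval (fun i => ∑ l, (y (i, l) : R) * b l) (f j) = 0 := by
    intro y
    simp_rw [← hg', ← CharP.cast_eq_zero_iff (ZMod p) p, hG', Prod.forall, Module.Basis.coord_apply]
    exact forall_congr' fun j => b.forall_coord_eq_zero_iff
  have hsm : ∀ (y : Fin N → ℕ), ∑ l, (y l : R) * b l = ∑ l, (y l : ZMod p) • b l := by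
    intro y
    simp [Algebra.smul_def]
  have hcount : Nat.card {x : Fin n → R // ∀ j, MvPolynomial.eval x (f j) = 0} =
      Finset.card {x ∈ Fintype.piFinset (fun _ : Fin n × Fin N => Finset.range p) |
        ∀ jl, p ∣ MvPolynomial.eval x (G jl)} := by
    classical
    rw [Nat.card_eq_fintype_card, Fintype.card_subtype]
    symm
    refine Finset.card_bij (fun y _ i => ∑ l, (y (i, l) : R) * b l) ?_ ?_ ?_
    · intro y hy
      rw [Finset.mem_filter] at hy
      simpa using (hval y).1 hy.2
    · intro y hy z hz h
      rw [Finset.mem_filter, Fintype.mem_piFinset] at hy hz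
      ext ⟨i, l⟩
      have h1 := congrFun h i
      simp only [hsm fun l => y (i, l), hsm fun l => z (i, l)] at h1
      have h2 := congrArg (fun v => b.repr v l) h1
      simp only [b.repr_sum_self] at h2
      have hy1 : y (i, l) < p := Finset.mem_range.1 (hy.1 (i, l))
      have hz1 : z (i, l) < p := Finset.mem_range.1 (hz.1 (i, l))
      rw [ZMod.natCast_eq_natCast_iff] at h2
      exact Nat.ModEq.eq_of_lt_of_lt h2 hy1 hz1
    · intro x hx
      have hx2 : ∀ j, MvPolynomial.eval x (f j) = 0 := by simpa using hx
      have hx1 : (fun i => ∑ l, (((b.repr (x i) l).val : ℕ) : R) * b l) = x := by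
        funext i
        rw [hsm fun l => (b.repr (x i) l).val]
        simp only [ZMod.natCast_zmod_val]
        exact b.sum_repr (x i)
      refine ⟨fun il => (b.repr (x il.1) il.2).val, ?_, hx1⟩
      rw [Finset.mem_filter, Fintype.mem_piFinset]
      refine ⟨fun il => Finset.mem_range.2 (ZMod.val_lt _), (hval _).2 fun j => ?_⟩
      simp only [hx1]
      exact hx2 j
  rw [hcount]
  have hD : 1 ≤ Finset.univ.sup fun j => pWeightDeg p (f j) := by
    have j : Fin r := ⟨0, hr⟩
    refine le_trans ?_ (Finset.le_sup (f := fun j => pWeightDeg p (f j)) (Finset.mem_univ j))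
    by_contra hcon
    have h0 : pWeightDeg p (f j) = 0 := by omega
    have h1 : (f j).totalDegree = 0 := by
      refine Nat.le_zero.1 (Finset.sup_le fun m hm => ?_)
      have h2 := Finset.le_sup (f := fun m : Fin n →₀ ℕ => ∑ i, (Nat.digits p (m i)).sum) hm
      change _ ≤ pWeightDeg p (f j) at h2
      rw [h0, Nat.le_zero, Finset.sum_eq_zero_iff] at h2
      rw [Finsupp.sum_fintype _ _ (by simp), Nat.le_zero, Finset.sum_eq_zero_iff]
      intro i hi
      have h3 := h2 i hi
      by_contra hne
      have h4 : Nat.digits p (m i) ≠ [] := Nat.digits_ne_nil_iff_ne_zero.2 hne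
      have h5 := Nat.getLast_digit_ne_zero p hne
      exact h5 (List.sum_eq_zero_iff.1 h3 _ (List.getLast_mem h4))
    have := hdeg j
    omega
  refine MM.ax_katz p hp G (fun jl => pWeightDeg p (f jl.1)) _ hD
    (fun jl => Finset.le_sup (f := fun j => pWeightDeg p (f j)) (Finset.mem_univ jl.1))
    (fun jl => (hG jl).trans (hg jl.1)) _ ?_
  intro v hv
  rw [Int.toNat_le, Int.ceil_le]
  rw [div_le_iff₀ (by exact_mod_cast hD)]
  rw [Fintype.sum_prod_type] at hv
  simp only [Fintype.card_prod, Fintype.card_fin, Finset.sum_const, Finset.card_univ,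
    smul_eq_mul, ← Finset.mul_sum] at hv
  have hv' : ((n : ℚ) * N) ≤ N * ∑ j, (pWeightDeg p (f j) : ℚ) +
      ((Finset.univ.sup fun j => pWeightDeg p (f j) : ℕ) : ℚ) * v := by exact_mod_cast hv
  push_cast
  linarith
end
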